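/- Let f(x) = 1/(x(1 - ln x)²) on (0,1). Then ∫_0^1 f(s) ds = 1 and -∫_0^1 f(s)·log₂ f(s) ds = -∞ (the integral of f·log₂ f diverges to +∞). Consequently, the diagonal state defined by α_σ = ∫_{[σ]} f satisfies H(ρ_n) - n → -∞. -/

import Mathlib

open MeasureTheory

open Filter Topology in
lemma tendsto_one_sub_log_nhdsGT_zero :
    Tendsto (fun x : ℝ => 1 - Real.log x) (𝓝[>] 0) atTop :=
  tendsto_const_nhds.add_atTop (tendsto_neg_atBot_atTop.comp Real.tendsto_log_nhdsGT_zero)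

lemma one_le_one_sub_log {x : ℝ} (hx : 0 < x) (hx1 : x ≤ 1) : 1 ≤ 1 - Real.log x := by
  linarith [Real.log_nonpos hx.le hx1]

/-- The primitive `1 / (1 - log x)` of `1 / (x (1 - log x)²)`, extended by `0` at the origin. -/
noncomputable def invOneSubLog : ℝ → ℝ := Function.update (fun x => (1 - Real.log x)⁻¹) 0 0

lemma invOneSubLog_zero : invOneSubLog 0 = 0 := by simp [invOneSubLog]

lemma invOneSubLog_one : invOneSubLog 1 = 1 := by simp [invOneSubLog]

lemma hasDerivAt_one_sub_log {x : ℝ} (hx : 0 < x) :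
    HasDerivAt (fun x => 1 - Real.log x) (-x⁻¹) x := by
  simpa using (Real.hasDerivAt_log hx.ne').const_sub 1

lemma hasDerivAt_invOneSubLog {x : ℝ} (hx : 0 < x) (hx1 : x ≤ 1) :
    HasDerivAt invOneSubLog (1 / (x * (1 - Real.log x) ^ 2)) x := by
  have hu := one_le_one_sub_log hx hx1
  have h := (hasDerivAt_one_sub_log hx).inv (by linarith)
  have he : invOneSubLog =ᶠ[nhds x] (fun x => 1 - Real.log x)⁻¹ := by
    filter_upwards [lt_mem_nhds hx] with y hy
    simp [invOneSubLog, hy.ne']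
  refine (h.congr_of_eventuallyEq he).congr_deriv ?_
  field_simp

lemma continuousOn_invOneSubLog : ContinuousOn invOneSubLog (Set.Icc 0 1) := by
  intro x hx
  rcases hx.1.eq_or_lt with rfl | h0
  · refine ContinuousWithinAt.mono ?_ Set.Icc_subset_Ici_self
    rw [← continuousWithinAt_Ioi_iff_Ici, ContinuousWithinAt, invOneSubLog_zero]
    refine (tendsto_one_sub_log_nhdsGT_zero.inv_tendsto_atTop).congr' ?_
    filter_upwards [self_mem_nhdsWithin] with y hy
    simp [invOneSubLog, (Set.mem_Ioi.1 hy).ne']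
  · exact (hasDerivAt_invOneSubLog h0 hx.2).continuousAt.continuousWithinAt

lemma density_nonneg {x : ℝ} (hx : 0 < x) : 0 ≤ 1 / (x * (1 - Real.log x) ^ 2) := by
  positivity

lemma intervalIntegrable_density {a b : ℝ} (ha : 0 ≤ a) (hab : a ≤ b) (hb : b ≤ 1) :
    IntervalIntegrable (fun x : ℝ => 1 / (x * (1 - Real.log x) ^ 2)) volume a b := by
  rw [intervalIntegrable_iff_integrableOn_Ioc_of_le hab]
  exact intervalIntegral.integrableOn_deriv_of_nonneg
    (continuousOn_invOneSubLog.mono (Set.Icc_subset_Icc ha hb))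
    (fun x hx => hasDerivAt_invOneSubLog (ha.trans_lt hx.1) (hx.2.le.trans hb))
    (fun x hx => density_nonneg (ha.trans_lt hx.1))

lemma setIntegral_Ioo_density {a b : ℝ} (ha : 0 ≤ a) (hab : a ≤ b) (hb : b ≤ 1) :
    ∫ x in Set.Ioo a b, 1 / (x * (1 - Real.log x) ^ 2) = invOneSubLog b - invOneSubLog a := by
  rw [← integral_Ioc_eq_integral_Ioo, ← intervalIntegral.integral_of_le hab]
  exact intervalIntegral.integral_eq_sub_of_hasDerivAt_of_le hab
    (continuousOn_invOneSubLog.mono (Set.Icc_subset_Icc ha hb))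
    (fun x hx => hasDerivAt_invOneSubLog (ha.trans_lt hx.1) (hx.2.le.trans hb))
    (intervalIntegrable_density ha hab hb)

lemma le_log_density {x : ℝ} (hx : 0 < x) (hx1 : x ≤ 1) :
    -Real.log x / 2 - 2 ≤ Real.log (1 / (x * (1 - Real.log x) ^ 2)) := by
  have hu := one_le_one_sub_log hx hx1
  have h4 : Real.log 4 = 2 * Real.log 2 := by
    rw [show (4 : ℝ) = 2 ^ 2 by norm_num, Real.log_pow]; norm_num
  have hlog := Real.log_le_sub_one_of_pos (show 0 < (1 - Real.log x) / 4 by linarith)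
  rw [Real.log_div (by linarith) (by norm_num), h4] at hlog
  rw [one_div, Real.log_inv, Real.log_mul hx.ne' (by positivity), Real.log_pow]
  push_cast
  linarith [Real.log_two_lt_d9]

/-- The mean of the density over `(a, b)` is at least `exp (-log b / 2 - 2)`. -/
lemma le_log_mean_density {a b : ℝ} (ha : 0 ≤ a) (hab : a < b) (hb : b ≤ 1) :
    0 < invOneSubLog b - invOneSubLog a ∧
    -Real.log b / 2 - 2 ≤ Real.log ((invOneSubLog b - invOneSubLog a) / (b - a)) := by
  have hba : 0 < b - a := sub_pos.2 hab
  have key : (b - a) * Real.exp (-Real.log b / 2 - 2) ≤ invOneSubLog b - invOneSubLog a := by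
    rw [← setIntegral_Ioo_density ha hab.le hb, ← integral_Ioc_eq_integral_Ioo,
      ← intervalIntegral.integral_of_le hab.le]
    calc (b - a) * Real.exp (-Real.log b / 2 - 2)
        = ∫ _ in a..b, Real.exp (-Real.log b / 2 - 2) := by simp
      _ ≤ _ := by
        refine intervalIntegral.integral_mono_on_of_le_Ioo hab.le (by simp)
          (intervalIntegrable_density ha hab.le hb) fun x hx => ?_
        have hx0 : 0 < x := ha.trans_lt hx.1
        have hx1 : x ≤ 1 := hx.2.le.trans hb
        have hu := one_le_one_sub_log hx0 hx1
        rw [← Real.le_log_iff_exp_le (by positivity)]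
        linarith [le_log_density hx0 hx1, Real.log_le_log hx0 hx.2.le]
  have hpos : 0 < invOneSubLog b - invOneSubLog a := lt_of_lt_of_le (by positivity) key
  refine ⟨hpos, ?_⟩
  rw [Real.le_log_iff_exp_le (by positivity), le_div_iff₀ hba]
  linarith

lemma hasDerivAt_neg_log_one_sub_log {x : ℝ} (hx : 0 < x) (hx1 : x ≤ 1) :
    HasDerivAt (fun x => -Real.log (1 - Real.log x)) (1 / (x * (1 - Real.log x))) x := by
  have hu := one_le_one_sub_log hx hx1
  refine ((hasDerivAt_one_sub_log hx).log (by linarith)).neg.congr_deriv ?_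
  field_simp

lemma neg_log_one_sub_log_sub_le {a b : ℝ} (ha : 0 < a) (hab : a ≤ b) (hb : b ≤ 1) :
    -Real.log (1 - Real.log b) - -Real.log (1 - Real.log a) ≤
      (1 - Real.log a) * (invOneSubLog b - invOneSubLog a) := by
  have hd : ∀ x ∈ Set.Icc a b, HasDerivAt
      (fun x => (1 - Real.log a) * invOneSubLog x - -Real.log (1 - Real.log x))
      ((1 - Real.log a) * (1 / (x * (1 - Real.log x) ^ 2)) - 1 / (x * (1 - Real.log x))) x :=
    fun x hx => ((hasDerivAt_invOneSubLog (ha.trans_le hx.1) (hx.2.trans hb)).const_mul _).sub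
      (hasDerivAt_neg_log_one_sub_log (ha.trans_le hx.1) (hx.2.trans hb))
  have hm := monotoneOn_of_hasDerivWithinAt_nonneg (convex_Icc a b)
    (fun x hx => (hd x hx).continuousAt.continuousWithinAt)
    (fun x hx => (hd x (interior_subset hx)).hasDerivWithinAt) (fun x hx => by
      have hx := interior_subset hx
      have hx0 := ha.trans_le hx.1
      have hu := one_le_one_sub_log hx0 (hx.2.trans hb)
      have hu0 : 0 < 1 - Real.log x := by linarith
      have : (1 - Real.log a) * (1 / (x * (1 - Real.log x) ^ 2)) - 1 / (x * (1 - Real.log x))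
          = (Real.log x - Real.log a) / (x * (1 - Real.log x) ^ 2) := by
        field_simp
        ring
      rw [this]
      exact div_nonneg (sub_nonneg.2 (Real.log_le_log ha hx.1)) (by positivity))
  have := hm (Set.left_mem_Icc.2 hab) (Set.right_mem_Icc.2 hab) hab
  simp only at this
  linarith

open Filter Topology in
lemma not_integrableOn_density_mul_logb :
    ¬ IntegrableOn (fun x : ℝ => 1 / (x * (1 - Real.log x) ^ 2) *
      Real.logb 2 (1 / (x * (1 - Real.log x) ^ 2))) (Set.Ioo 0 1) := by
  have hmem : Set.Ioo (0 : ℝ) 1 ∈ 𝓝[>] (0 : ℝ) := Ioo_mem_nhdsGT one_pos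
  refine not_integrableOn_of_tendsto_norm_atTop_of_deriv_isBigO_filter
    (f := fun x => -Real.log (1 - Real.log x)) (𝓝[>] 0) hmem ?_ ?_ ?_
  · filter_upwards [hmem] with x hx
    exact (hasDerivAt_neg_log_one_sub_log hx.1 hx.2.le).differentiableAt
  · simp only [norm_neg]
    exact tendsto_norm_atTop_atTop.comp
      (Real.tendsto_log_atTop.comp tendsto_one_sub_log_nhdsGT_zero)
  · refine Asymptotics.IsBigO.of_bound 4 ?_
    filter_upwards [hmem, tendsto_one_sub_log_nhdsGT_zero.eventually_ge_atTop 10] with x hx hu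
    have hx0 := hx.1
    have hu0 : 0 < 1 - Real.log x := by linarith
    have hl := le_log_density hx.1 hx.2.le
    have h2 : Real.log 2 ≤ 1 := by linarith [Real.log_two_lt_d9]
    have h2' := Real.log_pos one_lt_two
    have hlb : (1 - Real.log x) / 4 ≤ Real.logb 2 (1 / (x * (1 - Real.log x) ^ 2)) := by
      rw [Real.logb, le_div_iff₀ h2']
      nlinarith
    rw [(hasDerivAt_neg_log_one_sub_log hx.1 hx.2.le).deriv, norm_mul,
      Real.norm_of_nonneg (by positivity), Real.norm_of_nonneg (by positivity),
      Real.norm_of_nonneg (by linarith)]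
    calc 1 / (x * (1 - Real.log x))
        = 4 * (1 / (x * (1 - Real.log x) ^ 2) * ((1 - Real.log x) / 4)) := by
          field_simp
      _ ≤ _ := by gcongr

/-- Lower bound for one dyadic cell; the cell at the origin contributes no logarithm. -/
lemma le_cell_mul_log {N : ℕ} (j : ℕ) (hj : j < N) {p : ℝ}
    (hp : p = invOneSubLog (((j : ℝ) + 1) / N) - invOneSubLog ((j : ℝ) / N)) :
    0 < p ∧ (-Real.log (1 - Real.log ((max (j + 1) 1 : ℕ) / (N : ℝ)))
        - -Real.log (1 - Real.log ((max j 1 : ℕ) / (N : ℝ)))) / 2 - 3 * p ≤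
      p * Real.log (N * p) := by
  have hN : (0 : ℝ) < N := by exact_mod_cast (Nat.zero_le j).trans_lt hj
  have hb : ((j : ℝ) + 1) / N ≤ 1 := by
    rw [div_le_one hN]; exact_mod_cast hj
  have hab : (j : ℝ) / N < ((j : ℝ) + 1) / N := by gcongr; linarith
  obtain ⟨hpos, hmean⟩ := le_log_mean_density (by positivity) hab hb
  rw [← hp] at hpos hmean
  have hwidth : p / (((j : ℝ) + 1) / N - j / N) = N * p := by
    field_simp
    ring
  rw [hwidth] at hmean
  refine ⟨hpos, ?_⟩
  have hmul := mul_le_mul_of_nonneg_left hmean hpos.le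
  rcases Nat.eq_zero_or_pos j with rfl | hj0
  · have : Real.log (((0 : ℕ) + 1 : ℝ) / N) ≤ 0 := Real.log_nonpos (by positivity) hb
    simp only [zero_add, max_self, max_eq_right zero_le_one, sub_self]
    nlinarith
  · have hj' : (1 : ℝ) ≤ j := by exact_mod_cast hj0
    have ha : (0 : ℝ) < j / N := by positivity
    have hG := neg_log_one_sub_log_sub_le ha hab.le hb
    rw [← hp] at hG
    have hlog : Real.log (((j : ℝ) + 1) / N) ≤ Real.log ((j : ℝ) / N) + 1 := by
      have : ((j : ℝ) + 1) / N ≤ 2 * (j / N) := by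
        rw [← mul_div_assoc]; gcongr; linarith
      have := Real.log_le_log (by positivity) this
      rw [Real.log_mul two_ne_zero ha.ne'] at this
      linarith [Real.log_two_lt_d9]
    rw [max_eq_left (by omega : 1 ≤ j + 1), max_eq_left (by omega : 1 ≤ j)]
    push_cast
    nlinarith

theorem diagonal_state_entropy_atBot (f : ℝ → ℝ)
    (hf : ∀ x, f x = 1 / (x * (1 - Real.log x)^2))
    (α : (n : ℕ) → Fin (2^n) → ℝ)
    (hα : ∀ (n : ℕ) (j : Fin (2^n)),
      α n j = ∫ s in Set.Ioo ((j : ℝ)/2^n) (((j : ℝ)+1)/2^n), f s) :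
    (∫ s in Set.Ioo (0:ℝ) 1, f s = 1) ∧
    ¬ IntegrableOn (fun s => f s * Real.logb 2 (f s)) (Set.Ioo 0 1) ∧
    Filter.Tendsto (fun n : ℕ => (-∑ j, α n j * Real.logb 2 (α n j)) - (n : ℝ))
      Filter.atTop Filter.atBot := by
  obtain rfl : f = fun x => 1 / (x * (1 - Real.log x)^2) := funext hf
  refine ⟨?_, not_integrableOn_density_mul_logb, ?_⟩
  · rw [setIntegral_Ioo_density le_rfl zero_le_one le_rfl, invOneSubLog_zero, invOneSubLog_one,
      sub_zero]
  have h2 := Real.log_pos one_lt_two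
  have hcell : ∀ (n : ℕ) (j : Fin (2 ^ n)), α n j =
      invOneSubLog (((j : ℕ) + 1 : ℝ) / (2 ^ n : ℕ)) - invOneSubLog ((j : ℕ) / (2 ^ n : ℕ)) := by
    intro n j
    have hj : ((j : ℕ) : ℝ) + 1 ≤ 2 ^ n := by exact_mod_cast j.2
    rw [hα, setIntegral_Ioo_density (by positivity) (by gcongr; linarith)
      (by rw [div_le_one (by positivity)]; exact hj)]
    push_cast
    rfl
  have hsum : ∀ n : ℕ, ∑ j, α n j = 1 := by
    intro n
    have := Finset.sum_range_sub (fun j : ℕ => invOneSubLog ((j : ℝ) / (2 ^ n : ℕ))) (2 ^ n)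
    rw [Finset.sum_range] at this
    simp only [hcell]
    push_cast at this ⊢
    rw [this, div_self (by positivity), zero_div, invOneSubLog_zero, invOneSubLog_one, sub_zero]
  have hbound : ∀ n : ℕ, Real.log (1 + n * Real.log 2) / 2 - 3 ≤
      ∑ j, α n j * Real.log ((2 ^ n : ℕ) * α n j) := by
    intro n
    have hN : 1 ≤ 2 ^ n := Nat.one_le_two_pow
    have htel := Finset.sum_range_sub
      (fun j : ℕ => -Real.log (1 - Real.log ((max j 1 : ℕ) / ((2 ^ n : ℕ) : ℝ)))) (2 ^ n)
    rw [Finset.sum_range] at htel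
    have hle := Finset.sum_le_sum fun (j : Fin (2 ^ n)) (_ : j ∈ Finset.univ) =>
      (le_cell_mul_log j j.2 (hcell n j)).2
    rw [Finset.sum_sub_distrib, ← Finset.sum_div, ← Finset.mul_sum, hsum, htel,
      max_eq_left hN, Nat.zero_max, div_self (by positivity)] at hle
    have hlog : Real.log (((1 : ℕ) : ℝ) / (2 ^ n : ℕ)) = -(n * Real.log 2) := by
      push_cast
      rw [one_div, Real.log_inv, Real.log_pow]
    rw [hlog] at hle
    simp only [Real.log_one, sub_zero, sub_neg_eq_add, neg_zero, zero_add, mul_one] at hle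
    exact hle
  have hent : ∀ n : ℕ, (-∑ j, α n j * Real.logb 2 (α n j)) - (n : ℝ) =
      -((∑ j, α n j * Real.log ((2 ^ n : ℕ) * α n j)) / Real.log 2) := by
    intro n
    have hterm : ∀ j, α n j * Real.log ((2 ^ n : ℕ) * α n j) =
        (α n j * Real.logb 2 (α n j)) * Real.log 2 + α n j * (n * Real.log 2) := by
      intro j
      have hpos := (le_cell_mul_log j j.2 (hcell n j)).1
      rw [Real.log_mul (by positivity) hpos.ne', Real.logb]
      push_cast
      rw [Real.log_pow]
      field_simp
      ring
    simp only [hterm]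
    rw [Finset.sum_add_distrib, ← Finset.sum_mul, ← Finset.sum_mul, hsum]
    field_simp
    ring
  simp only [hent]
  refine Filter.tendsto_neg_atTop_atBot.comp (Filter.Tendsto.atTop_div_const h2
    (Filter.tendsto_atTop_mono hbound ?_))
  refine Filter.tendsto_atTop_add_const_right _ _ (Filter.Tendsto.atTop_div_const two_pos
    (Real.tendsto_log_atTop.comp (Filter.tendsto_atTop_add_const_left _ _
      (tendsto_natCast_atTop_atTop.atTop_mul_const h2))))
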